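/- arXiv:1504.04589 — 3 statements merged into one kernel-verified Lean document; each statement's English description precedes it below -/
import Mathlib

section
/- Consider the original MILP and semi-coarse data as in the context. Suppose (y, x̄, v̄, w̄) is semi-coarse feasible: every entry of y lies in {0,1}; each x̄_{ik} ∈ {0,1} with Σ_{k=1}^K x̄_{ik} ≤ 1 for each i; each v̄_{ijk} ∈ [0,1] with Σ_{j=1}^{I_k} v̄_{ijk} = x̄_{ik} for each i,k and Σ_{k=1}^K Σ_{j=1}^{I_k} v̄_{ijk} ≤ 1 for each i; each w̄_{ij} ∈ [0,1] with Σ_{j=1}^J w̄_{ij} ≤ 1 for each i; and A y + Σ_{i,k} x̄_{ik} B_i X̄_k + Σ_{i,j,k} v̄_{ijk} C_i V̄_{jk} + Σ_{i,j} w̄_{ij} D_i W̄_j ≤ f entrywise. Define the reconstruction x_i := Σ_k x̄_{ik} X̄_k, v_i := Σ_{j,k} v̄_{ijk} V̄_{jk}, w_i := Σ_j w̄_{ij} W̄_j for i = 1,…,n, and let x, v, w ∈ ℝ^{n·δ} be the corresponding concatenated vectors. Then (y, x, v, w) is feasible for the original MILP: every entry of x lies in {0,1}; L·x ≤ v ≤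 U·x entrywise; w ≥ 0 entrywise; and A y + B x + C v + D w ≤ f entrywise. -/
open Finset Matrix

/-- A sum of binary reals that is at most one is itself binary. -/
theorem sum_eq_zero_or_one_of_le_one {ι : Type*} [Fintype ι] (a : ι → ℝ)
    (ha : ∀ i, a i = 0 ∨ a i = 1) (hsum : ∑ i, a i ≤ 1) :
    ∑ i, a i = 0 ∨ ∑ i, a i = 1 := by
  have hnonneg : ∀ i, 0 ≤ a i := fun i => by rcases ha i with h | h <;> simp [h]
  by_cases hone : ∃ i, a i = 1
  · obtain ⟨i, hi⟩ := hone
    have hle := Finset.single_le_sum (fun j _ => hnonneg j) (Finset.mem_univ i)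
    exact Or.inr (le_antisymm hsum (hi ▸ hle))
  · push Not at hone
    exact Or.inl (Finset.sum_eq_zero fun i _ => (ha i).resolve_right (hone i))

/-- A row applied to a vector whose blocks are combinations of profiles. -/
theorem sum_mul_eq_sum_mul_profiles {ι κ τ : Type*} [Fintype ι] [Fintype κ] [Fintype τ]
    (R z : ι × κ → ℝ) (c : ι → τ → ℝ) (P : τ → κ → ℝ)
    (hz : ∀ i h, z (i, h) = ∑ t, c i t * P t h) :
    ∑ p, R p * z p = ∑ i, ∑ t, c i t * ∑ h, R (i, h) * P t h := by
  rw [Fintype.sum_prod_type]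
  refine Finset.sum_congr rfl fun i _ => ?_
  simp only [hz, Finset.mul_sum]
  rw [Finset.sum_comm]
  exact Finset.sum_congr rfl fun t _ => Finset.sum_congr rfl fun h _ => by ring

/-- Proposition 1 of the paper: any feasible point of the semi-coarse model
reconstructs to a feasible point of the original MILP. -/
theorem semi_coarse_feasible_reconstructs_MILP_feasible
    (m M n δ K J : ℕ) (hm : 0 < m) (hM : 0 < M) (hn : 0 < n) (hδ : 0 < δ)
    (hK : 0 < K) (hJ : 0 < J) (I : Fin K → ℕ) (hI : ∀ k, 0 < I k)
    (A : Matrix (Fin M) (Fin m) ℝ)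
    (B C D : Matrix (Fin M) (Fin n × Fin δ) ℝ)
    (f : Fin M → ℝ) (L U : ℝ) (hLU : L ≤ U)
    -- profile data
    (Xb : Fin K → Fin δ → ℝ)
    (hXb : ∀ k h, Xb k h = 0 ∨ Xb k h = 1)
    (Vb : (k : Fin K) → Fin (I k) → Fin δ → ℝ)
    (hVb : ∀ k j h, L * Xb k h ≤ Vb k j h ∧ Vb k j h ≤ U * Xb k h)
    (Wb : Fin J → Fin δ → ℝ)
    (hWb : ∀ j h, 0 ≤ Wb j h)
    -- a semi-coarse feasible point
    (y : Fin m → ℝ) (hy : ∀ r, y r = 0 ∨ y r = 1)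
    (xb : Fin n → Fin K → ℝ)
    (hxb01 : ∀ i k, xb i k = 0 ∨ xb i k = 1)
    (hxbsum : ∀ i, ∑ k, xb i k ≤ 1)
    (vb : Fin n → (k : Fin K) → Fin (I k) → ℝ)
    (hvb01 : ∀ i k j, 0 ≤ vb i k j ∧ vb i k j ≤ 1)
    (hvbx : ∀ i k, ∑ j, vb i k j = xb i k)
    (hvbsum : ∀ i, ∑ k, ∑ j, vb i k j ≤ 1)
    (wb : Fin n → Fin J → ℝ)
    (hwb01 : ∀ i j, 0 ≤ wb i j ∧ wb i j ≤ 1)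
    (hwbsum : ∀ i, ∑ j, wb i j ≤ 1)
    (hlin : ∀ r, A.mulVec y r
        + (∑ i, ∑ k, xb i k * ∑ h, B r (i, h) * Xb k h)
        + (∑ i, ∑ k, ∑ j, vb i k j * ∑ h, C r (i, h) * Vb k j h)
        + (∑ i, ∑ j, wb i j * ∑ h, D r (i, h) * Wb j h) ≤ f r)
    -- the reconstructed fine-scale point
    (x v w : Fin n × Fin δ → ℝ)
    (hx : ∀ i h, x (i, h) = ∑ k, xb i k * Xb k h)
    (hv : ∀ i h, v (i, h) = ∑ k, ∑ j, vb i k j * Vb k j h)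
    (hw : ∀ i h, w (i, h) = ∑ j, wb i j * Wb j h) :
    (∀ p, x p = 0 ∨ x p = 1) ∧
    (∀ p, L * x p ≤ v p ∧ v p ≤ U * x p) ∧
    (∀ p, 0 ≤ w p) ∧
    (∀ r, A.mulVec y r + B.mulVec x r + C.mulVec v r + D.mulVec w r ≤ f r) := by
  refine ⟨?_, ?_, ?_, ?_⟩
  · rintro ⟨i, h⟩
    rw [hx]
    refine sum_eq_zero_or_one_of_le_one _ (fun k => ?_) (le_trans ?_ (hxbsum i))
    · rcases hxb01 i k with h₁ | h₁ <;> rcases hXb k h with h₂ | h₂ <;> simp [h₁, h₂]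
    · refine Finset.sum_le_sum fun k _ => ?_
      rcases hxb01 i k with h₁ | h₁ <;> rcases hXb k h with h₂ | h₂ <;> simp [h₁, h₂]
  · rintro ⟨i, h⟩
    have scale : ∀ c : ℝ, c * x (i, h) = ∑ k, ∑ j, vb i k j * (c * Xb k h) := fun c => by
      simp only [hx, ← hvbx, Finset.mul_sum, Finset.sum_mul]
      exact Finset.sum_congr rfl fun k _ => Finset.sum_congr rfl fun j _ => by ring
    rw [scale, scale, hv]
    exact ⟨Finset.sum_le_sum fun k _ => Finset.sum_le_sum fun j _ =>
        mul_le_mul_of_nonneg_left (hVb k j h).1 (hvb01 i k j).1,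
      Finset.sum_le_sum fun k _ => Finset.sum_le_sum fun j _ =>
        mul_le_mul_of_nonneg_left (hVb k j h).2 (hvb01 i k j).1⟩
  · rintro ⟨i, h⟩
    rw [hw]
    exact Finset.sum_nonneg fun j _ => mul_nonneg (hwb01 i j).1 (hWb j h)
  · intro r
    have hB : B.mulVec x r = _ := sum_mul_eq_sum_mul_profiles (B r) x xb Xb hx
    have hC : C.mulVec v r = _ :=
      sum_mul_eq_sum_mul_profiles (τ := (k : Fin K) × Fin (I k)) (C r) v
        (fun i t => vb i t.1 t.2) (fun t => Vb t.1 t.2)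
        (fun i h => by rw [hv, Fintype.sum_sigma])
    have hD : D.mulVec w r = _ := sum_mul_eq_sum_mul_profiles (D r) w wb Wb hw
    simp only [Fintype.sum_sigma] at hC
    rw [hB, hC, hD]
    exact hlin r
end

section
/- Consider the original MILP, profile data, and semi-coarse model as in the context, with objective vectors a ∈ ℝ^m and b, c, d ∈ ℝ^{n·δ}. Then the set of objective values attained at semi-coarse feasible points, Z_semi := { aᵀy + Σ_{i,k} x̄_{ik} b_iᵀX̄_k + Σ_{i,j,k} v̄_{ijk} c_iᵀV̄_{jk} + Σ_{i,j} w̄_{ij} d_iᵀW̄_j : (y, x̄, v̄, w̄) semi-coarse feasible }, is a subset of the set of objective values attained at MILP-feasible points, Z_MILP := { aᵀy + bᵀx + cᵀv + dᵀw : (y, x, v, w) MILP-feasible }. -/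
open Finset Matrix

/-- A sum of numbers from `{0, 1}` that is at most `1` lies in `{0, 1}`. -/
theorem sum_eq_zero_or_one_of_le_one_s6 {κ : Type*} [Fintype κ] {t : κ → ℝ}
    (ht : ∀ k, t k = 0 ∨ t k = 1) (hsum : ∑ k, t k ≤ 1) :
    ∑ k, t k = 0 ∨ ∑ k, t k = 1 := by
  have hnat : ∀ k, ∃ q : ℕ, t k = q := fun k =>
    (ht k).elim (fun h => ⟨0, by simp [h]⟩) (fun h => ⟨1, by simp [h]⟩)
  choose q hq using hnat
  have hcast : ∑ k, t k = ((∑ k, q k : ℕ) : ℝ) := by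
    push_cast
    exact Finset.sum_congr rfl fun k _ => hq k
  rw [hcast] at hsum ⊢
  have hle : ∑ k, q k ≤ 1 := by exact_mod_cast hsum
  rcases Nat.le_one_iff_eq_zero_or_eq_one.mp hle with h | h <;> simp [h]

/-- Pairing a vector with blockwise combinations of profiles. -/
theorem sum_mul_profile_combination {ι κ η : Type*} [Fintype ι] [Fintype κ] [Fintype η]
    (g : ι × η → ℝ) (s : ι → κ → ℝ) (P : κ → η → ℝ) :
    ∑ p, g p * ∑ k, s p.1 k * P k p.2 = ∑ i, ∑ k, s i k * ∑ h, g (i, h) * P k h := by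
  rw [Fintype.sum_prod_type]
  refine Finset.sum_congr rfl fun i _ => ?_
  simp only [Finset.mul_sum]
  rw [Finset.sum_comm]
  exact Finset.sum_congr rfl fun k _ => Finset.sum_congr rfl fun h _ => mul_left_comm _ _ _

/-- Pairing a vector with blockwise combinations of doubly indexed profiles. -/
theorem sum_mul_profile_combination_sigma {ι κ η : Type*} {τ : κ → Type*} [Fintype ι]
    [Fintype κ] [Fintype η] [∀ k, Fintype (τ k)]
    (g : ι × η → ℝ) (s : ι → (k : κ) → τ k → ℝ) (P : (k : κ) → τ k → η → ℝ) :
    ∑ p, g p * ∑ k, ∑ j, s p.1 k j * P k j p.2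
      = ∑ i, ∑ k, ∑ j, s i k j * ∑ h, g (i, h) * P k j h := by
  simpa only [Fintype.sum_sigma] using
    sum_mul_profile_combination g (fun i (q : Σ k, τ k) => s i q.1 q.2) (fun q => P q.1 q.2)

/-- First half of Proposition 2 of the paper: the set of objective values
attained at semi-coarse feasible points is a subset of the set of objective
values attained at MILP-feasible points (the semi-coarse model is a
tightening of the MILP). -/
theorem semi_coarse_values_subset_milp_values
    (m M n δ K J : ℕ) (hm : 0 < m) (hM : 0 < M) (hn : 0 < n) (hδ : 0 < δ)
    (hK : 0 < K) (hJ : 0 < J) (I : Fin K → ℕ) (hI : ∀ k, 0 < I k)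
    (A : Matrix (Fin M) (Fin m) ℝ)
    (B C D : Matrix (Fin M) (Fin n × Fin δ) ℝ)
    (a : Fin m → ℝ) (b c d : Fin n × Fin δ → ℝ)
    (f : Fin M → ℝ) (L U : ℝ) (hLU : L ≤ U)
    (Xb : Fin K → Fin δ → ℝ)
    (hXb : ∀ k h, Xb k h = 0 ∨ Xb k h = 1)
    (Vb : (k : Fin K) → Fin (I k) → Fin δ → ℝ)
    (hVb : ∀ k j h, L * Xb k h ≤ Vb k j h ∧ Vb k j h ≤ U * Xb k h)
    (Wb : Fin J → Fin δ → ℝ)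
    (hWb : ∀ j h, 0 ≤ Wb j h)
    (Zsemi Zmilp : Set ℝ)
    (hZsemi : Zsemi = {z : ℝ | ∃ (y : Fin m → ℝ) (xb : Fin n → Fin K → ℝ)
        (vb : Fin n → (k : Fin K) → Fin (I k) → ℝ) (wb : Fin n → Fin J → ℝ),
        ((∀ r, y r = 0 ∨ y r = 1) ∧
         (∀ i k, xb i k = 0 ∨ xb i k = 1) ∧ (∀ i, ∑ k, xb i k ≤ 1) ∧
         (∀ i k j, 0 ≤ vb i k j ∧ vb i k j ≤ 1) ∧
         (∀ i k, ∑ j, vb i k j = xb i k) ∧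
         (∀ i, ∑ k, ∑ j, vb i k j ≤ 1) ∧
         (∀ i j, 0 ≤ wb i j ∧ wb i j ≤ 1) ∧ (∀ i, ∑ j, wb i j ≤ 1) ∧
         (∀ r, A.mulVec y r
            + (∑ i, ∑ k, xb i k * ∑ h, B r (i, h) * Xb k h)
            + (∑ i, ∑ k, ∑ j, vb i k j * ∑ h, C r (i, h) * Vb k j h)
            + (∑ i, ∑ j, wb i j * ∑ h, D r (i, h) * Wb j h) ≤ f r)) ∧
        z = (∑ r, a r * y r)
            + (∑ i, ∑ k, xb i k * ∑ h, b (i, h) * Xb k h)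
            + (∑ i, ∑ k, ∑ j, vb i k j * ∑ h, c (i, h) * Vb k j h)
            + (∑ i, ∑ j, wb i j * ∑ h, d (i, h) * Wb j h)})
    (hZmilp : Zmilp = {z : ℝ | ∃ (y : Fin m → ℝ) (x v w : Fin n × Fin δ → ℝ),
        ((∀ r, y r = 0 ∨ y r = 1) ∧ (∀ p, x p = 0 ∨ x p = 1) ∧
         (∀ p, L * x p ≤ v p ∧ v p ≤ U * x p) ∧ (∀ p, 0 ≤ w p) ∧
         (∀ r, A.mulVec y r + B.mulVec x r + C.mulVec v r + D.mulVec w r ≤ f r)) ∧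
        z = (∑ r, a r * y r) + (∑ p, b p * x p) + (∑ p, c p * v p) + (∑ p, d p * w p)}) :
    Zsemi ⊆ Zmilp := by
  subst hZsemi hZmilp
  rintro z ⟨y, xb, vb, wb, ⟨hy, hx, hx1, hv, hvx, -, hw, -, hf⟩, rfl⟩
  have scale : ∀ (t : ℝ) i h,
      t * ∑ k, xb i k * Xb k h = ∑ k, ∑ j, vb i k j * (t * Xb k h) := by
    intro t i h
    rw [Finset.mul_sum]
    refine Finset.sum_congr rfl fun k _ => ?_
    rw [← Finset.sum_mul, hvx, mul_left_comm]
  refine ⟨y, fun p => ∑ k, xb p.1 k * Xb k p.2, fun p => ∑ k, ∑ j, vb p.1 k j * Vb k j p.2,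
    fun p => ∑ j, wb p.1 j * Wb j p.2, ⟨hy, ?_, ?_, ?_, ?_⟩, ?_⟩
  · rintro ⟨i, h⟩
    refine sum_eq_zero_or_one_of_le_one_s6 (fun k => ?_)
      ((Finset.sum_le_sum fun k _ => ?_).trans (hx1 i))
    · rcases hx i k with h1 | h1 <;> rcases hXb k h with h2 | h2 <;> simp [h1, h2]
    · rcases hx i k with h1 | h1 <;> rcases hXb k h with h2 | h2 <;> simp [h1, h2]
  · rintro ⟨i, h⟩
    simp only [scale]
    exact ⟨Finset.sum_le_sum fun k _ => Finset.sum_le_sum fun j _ =>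
        mul_le_mul_of_nonneg_left (hVb k j h).1 (hv i k j).1,
      Finset.sum_le_sum fun k _ => Finset.sum_le_sum fun j _ =>
        mul_le_mul_of_nonneg_left (hVb k j h).2 (hv i k j).1⟩
  · exact fun p => Finset.sum_nonneg fun j _ => mul_nonneg (hw p.1 j).1 (hWb j p.2)
  · intro r
    have hB := sum_mul_profile_combination (B r) xb Xb
    have hC := sum_mul_profile_combination_sigma (C r) vb Vb
    have hD := sum_mul_profile_combination (D r) wb Wb
    have hr := hf r
    rw [← hB, ← hC, ← hD] at hr
    exact hr
  · rw [sum_mul_profile_combination b, sum_mul_profile_combination_sigma c,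
      sum_mul_profile_combination d]
end

section
/- Consider the original MILP and semi-coarse model as in the context. Suppose (y*, x*, v*, w*) is MILP-feasible, Z_MILP is bounded below, and the MILP objective value at (y*, x*, v*, w*) equals sInf Z_MILP. Suppose moreover that there exist coefficients (x̄*, v̄*, w̄*) such that (y*, x̄*, v̄*, w̄*) is semi-coarse feasible and the reconstruction recovers the optimal point: x*_i = Σ_k x̄*_{ik} X̄_k, v*_i = Σ_{j,k} v̄*_{ijk} V̄_{jk}, w*_i = Σ_j w̄*_{ij} W̄_j for every i. Then sInf Z_semi = sInf Z_MILP, and the semi-coarse objective value at (y*, x̄*, v̄*, w̄*) equals sInf Z_semi (so (y*, x̄*, v̄*, w̄*) is optimal for the semi-coarse model). -/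
open Finset Matrix

/-- A linear functional of a profile combination, grouped by profile. -/
lemma sum_prod_mul_combination {ι κ σ : Type*} [Fintype ι] [Fintype κ] [Fintype σ]
    (g : ι × κ → ℝ) (t : ι → σ → ℝ) (P : σ → κ → ℝ) :
    ∑ p, g p * ∑ s, t p.1 s * P s p.2 = ∑ i, ∑ s, t i s * ∑ h, g (i, h) * P s h := by
  rw [Fintype.sum_prod_type]
  refine Finset.sum_congr rfl fun i _ => ?_
  simp only [Finset.mul_sum]
  rw [Finset.sum_comm]
  exact Finset.sum_congr rfl fun s _ => Finset.sum_congr rfl fun h _ => by ring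

/-- A linear functional of a combination of profiles indexed by a dependent family, grouped by
profile. -/
lemma sum_prod_mul_sigma_combination {ι κ σ : Type*} {τ : σ → Type*} [Fintype ι] [Fintype κ]
    [Fintype σ] [∀ s, Fintype (τ s)]
    (g : ι × κ → ℝ) (t : ι → (s : σ) → τ s → ℝ) (P : (s : σ) → τ s → κ → ℝ) :
    ∑ p, g p * ∑ s, ∑ j, t p.1 s j * P s j p.2
      = ∑ i, ∑ s, ∑ j, t i s j * ∑ h, g (i, h) * P s j h := by
  have key := sum_prod_mul_combination (σ := Sigma τ) g (fun i q => t i q.1 q.2)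
    (fun q => P q.1 q.2)
  simpa only [Fintype.sum_sigma] using key

/-- A combination of binary numbers with binary coefficients of total at most one is binary. -/
lemma binary_combination {σ : Type*} [Fintype σ] {t P : σ → ℝ}
    (ht : ∀ s, t s = 0 ∨ t s = 1) (hsum : ∑ s, t s ≤ 1) (hP : ∀ s, P s = 0 ∨ P s = 1) :
    ∑ s, t s * P s = 0 ∨ ∑ s, t s * P s = 1 := by
  have hnonneg : ∀ s, 0 ≤ t s * P s := fun s => by
    rcases ht s with h | h <;> rcases hP s with h' | h' <;> simp [h, h']
  have hle : ∀ s, t s * P s ≤ t s := fun s => by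
    rcases ht s with h | h <;> rcases hP s with h' | h' <;> simp [h, h']
  by_cases hone : ∃ s, t s * P s = 1
  · obtain ⟨s, hs⟩ := hone
    have h1 : t s * P s ≤ ∑ s, t s * P s :=
      Finset.single_le_sum (f := fun s => t s * P s) (fun s _ => hnonneg s) (Finset.mem_univ s)
    have h2 : ∑ s, t s * P s ≤ ∑ s, t s := Finset.sum_le_sum fun s _ => hle s
    right
    linarith
  · left
    refine Finset.sum_eq_zero fun s _ => ?_
    rcases ht s with h | h
    · simp [h]
    · rcases hP s with h' | h'
      · simp [h']
      · exact absurd ⟨s, by simp [h, h']⟩ hone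

/-- Equivalence assertion of Proposition 2 of the paper: if the optimal
profiles of an optimal MILP solution are included (i.e., the optimal point is
reconstructed from a semi-coarse feasible point), then the two problems have
the same optimal value, and that semi-coarse point is optimal for the
semi-coarse model. -/
theorem semi_coarse_equivalent_when_optimal_profiles_included
    (m M n δ K J : ℕ) (hm : 0 < m) (hM : 0 < M) (hn : 0 < n) (hδ : 0 < δ)
    (hK : 0 < K) (hJ : 0 < J) (I : Fin K → ℕ) (hI : ∀ k, 0 < I k)
    (A : Matrix (Fin M) (Fin m) ℝ)
    (B C D : Matrix (Fin M) (Fin n × Fin δ) ℝ)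
    (a : Fin m → ℝ) (b c d : Fin n × Fin δ → ℝ)
    (f : Fin M → ℝ) (L U : ℝ) (hLU : L ≤ U)
    (Xb : Fin K → Fin δ → ℝ)
    (hXb : ∀ k h, Xb k h = 0 ∨ Xb k h = 1)
    (Vb : (k : Fin K) → Fin (I k) → Fin δ → ℝ)
    (hVb : ∀ k j h, L * Xb k h ≤ Vb k j h ∧ Vb k j h ≤ U * Xb k h)
    (Wb : Fin J → Fin δ → ℝ)
    (hWb : ∀ j h, 0 ≤ Wb j h)
    (Zsemi Zmilp : Set ℝ)
    (hZsemi : Zsemi = {z : ℝ | ∃ (y : Fin m → ℝ) (xb : Fin n → Fin K → ℝ)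
        (vb : Fin n → (k : Fin K) → Fin (I k) → ℝ) (wb : Fin n → Fin J → ℝ),
        ((∀ r, y r = 0 ∨ y r = 1) ∧
         (∀ i k, xb i k = 0 ∨ xb i k = 1) ∧ (∀ i, ∑ k, xb i k ≤ 1) ∧
         (∀ i k j, 0 ≤ vb i k j ∧ vb i k j ≤ 1) ∧
         (∀ i k, ∑ j, vb i k j = xb i k) ∧
         (∀ i, ∑ k, ∑ j, vb i k j ≤ 1) ∧
         (∀ i j, 0 ≤ wb i j ∧ wb i j ≤ 1) ∧ (∀ i, ∑ j, wb i j ≤ 1) ∧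
         (∀ r, A.mulVec y r
            + (∑ i, ∑ k, xb i k * ∑ h, B r (i, h) * Xb k h)
            + (∑ i, ∑ k, ∑ j, vb i k j * ∑ h, C r (i, h) * Vb k j h)
            + (∑ i, ∑ j, wb i j * ∑ h, D r (i, h) * Wb j h) ≤ f r)) ∧
        z = (∑ r, a r * y r)
            + (∑ i, ∑ k, xb i k * ∑ h, b (i, h) * Xb k h)
            + (∑ i, ∑ k, ∑ j, vb i k j * ∑ h, c (i, h) * Vb k j h)
            + (∑ i, ∑ j, wb i j * ∑ h, d (i, h) * Wb j h)})
    (hZmilp : Zmilp = {z : ℝ | ∃ (y : Fin m → ℝ) (x v w : Fin n × Fin δ → ℝ),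
        ((∀ r, y r = 0 ∨ y r = 1) ∧ (∀ p, x p = 0 ∨ x p = 1) ∧
         (∀ p, L * x p ≤ v p ∧ v p ≤ U * x p) ∧ (∀ p, 0 ≤ w p) ∧
         (∀ r, A.mulVec y r + B.mulVec x r + C.mulVec v r + D.mulVec w r ≤ f r)) ∧
        z = (∑ r, a r * y r) + (∑ p, b p * x p) + (∑ p, c p * v p) + (∑ p, d p * w p)})
    (hbdd : BddBelow Zmilp)
    -- an optimal MILP point
    (ys : Fin m → ℝ) (xs vs ws : Fin n × Fin δ → ℝ)
    (hfeas : (∀ r, ys r = 0 ∨ ys r = 1) ∧ (∀ p, xs p = 0 ∨ xs p = 1) ∧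
      (∀ p, L * xs p ≤ vs p ∧ vs p ≤ U * xs p) ∧ (∀ p, 0 ≤ ws p) ∧
      (∀ r, A.mulVec ys r + B.mulVec xs r + C.mulVec vs r + D.mulVec ws r ≤ f r))
    (hopt : (∑ r, a r * ys r) + (∑ p, b p * xs p) + (∑ p, c p * vs p)
        + (∑ p, d p * ws p) = sInf Zmilp)
    -- semi-coarse coefficients that reconstruct the optimal point
    (xbs : Fin n → Fin K → ℝ)
    (vbs : Fin n → (k : Fin K) → Fin (I k) → ℝ)
    (wbs : Fin n → Fin J → ℝ)
    (hsemifeas : (∀ r, ys r = 0 ∨ ys r = 1) ∧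
      (∀ i k, xbs i k = 0 ∨ xbs i k = 1) ∧ (∀ i, ∑ k, xbs i k ≤ 1) ∧
      (∀ i k j, 0 ≤ vbs i k j ∧ vbs i k j ≤ 1) ∧
      (∀ i k, ∑ j, vbs i k j = xbs i k) ∧
      (∀ i, ∑ k, ∑ j, vbs i k j ≤ 1) ∧
      (∀ i j, 0 ≤ wbs i j ∧ wbs i j ≤ 1) ∧ (∀ i, ∑ j, wbs i j ≤ 1) ∧
      (∀ r, A.mulVec ys r
        + (∑ i, ∑ k, xbs i k * ∑ h, B r (i, h) * Xb k h)
        + (∑ i, ∑ k, ∑ j, vbs i k j * ∑ h, C r (i, h) * Vb k j h)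
        + (∑ i, ∑ j, wbs i j * ∑ h, D r (i, h) * Wb j h) ≤ f r))
    (hxrec : ∀ i h, xs (i, h) = ∑ k, xbs i k * Xb k h)
    (hvrec : ∀ i h, vs (i, h) = ∑ k, ∑ j, vbs i k j * Vb k j h)
    (hwrec : ∀ i h, ws (i, h) = ∑ j, wbs i j * Wb j h) :
    sInf Zsemi = sInf Zmilp ∧
    (∑ r, a r * ys r)
      + (∑ i, ∑ k, xbs i k * ∑ h, b (i, h) * Xb k h)
      + (∑ i, ∑ k, ∑ j, vbs i k j * ∑ h, c (i, h) * Vb k j h)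
      + (∑ i, ∑ j, wbs i j * ∑ h, d (i, h) * Wb j h) = sInf Zsemi := by
  have hsub : Zsemi ⊆ Zmilp := by
    rw [hZsemi, hZmilp]
    rintro z ⟨y, xb, vb, wb, ⟨hy, hxb, hxs, hv, hvx, -, hw, -, hcon⟩, rfl⟩
    have hscale : ∀ (q : ℝ) (i : Fin n) (h : Fin δ),
        q * ∑ k, xb i k * Xb k h = ∑ k, ∑ j, vb i k j * (q * Xb k h) := by
      intro q i h
      rw [Finset.mul_sum]
      refine Finset.sum_congr rfl fun k _ => ?_
      rw [← Finset.sum_mul, hvx]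
      ring
    refine ⟨y, fun p => ∑ k, xb p.1 k * Xb k p.2, fun p => ∑ k, ∑ j, vb p.1 k j * Vb k j p.2,
      fun p => ∑ j, wb p.1 j * Wb j p.2, ⟨hy, ?_, ?_, ?_, ?_⟩, ?_⟩
    · exact fun p => binary_combination (hxb p.1) (hxs p.1) fun k => hXb k p.2
    · intro p
      rw [hscale, hscale]
      exact ⟨Finset.sum_le_sum fun k _ => Finset.sum_le_sum fun j _ =>
          mul_le_mul_of_nonneg_left (hVb k j p.2).1 (hv p.1 k j).1,
        Finset.sum_le_sum fun k _ => Finset.sum_le_sum fun j _ =>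
          mul_le_mul_of_nonneg_left (hVb k j p.2).2 (hv p.1 k j).1⟩
    · exact fun p => Finset.sum_nonneg fun j _ => mul_nonneg (hw p.1 j).1 (hWb j p.2)
    · intro r
      have hB := sum_prod_mul_combination (B r) xb Xb
      have hC := sum_prod_mul_sigma_combination (C r) vb Vb
      have hD := sum_prod_mul_combination (D r) wb Wb
      have hr := hcon r
      rw [← hB, ← hC, ← hD] at hr
      exact hr
    · rw [sum_prod_mul_combination, sum_prod_mul_sigma_combination, sum_prod_mul_combination]
  have hobj : (∑ r, a r * ys r)
      + (∑ i, ∑ k, xbs i k * ∑ h, b (i, h) * Xb k h)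
      + (∑ i, ∑ k, ∑ j, vbs i k j * ∑ h, c (i, h) * Vb k j h)
      + (∑ i, ∑ j, wbs i j * ∑ h, d (i, h) * Wb j h) = sInf Zmilp := by
    rw [← hopt, ← sum_prod_mul_combination, ← sum_prod_mul_sigma_combination,
      ← sum_prod_mul_combination]
    simp only [← hxrec, ← hvrec, ← hwrec]
  have hmem : sInf Zmilp ∈ Zsemi := by
    rw [← hobj, hZsemi]
    exact ⟨ys, xbs, vbs, wbs, hsemifeas, rfl⟩
  have heq : sInf Zsemi = sInf Zmilp :=
    le_antisymm (csInf_le (hbdd.mono hsub) hmem) (csInf_le_csInf hbdd ⟨_, hmem⟩ hsub)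
  exact ⟨heq, hobj.trans heq.symm⟩
end
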